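/- (Termination.) Let 𝒴 = {y_1, …, y_K} with π(y_1) ≤ … ≤ π(y_K) = 1 and π_i = π(y_i), let p̂ ∈ ℙ(𝒴) be strictly positive, let Y ⊆ 𝒴 be a nonempty set of unassigned classes, and suppose probabilities p^r(y) ∈ [0,1] are already fixed for all y ∈ 𝒴\Y such that: (a) π(y) ≤ min_{y'∈Y} π(y') for all y ∈ 𝒴\Y, (b) the fixed values satisfy ∑_{k=1}^{j} p^r(y_k) ≤ π_j for every index j with y_j ∈ 𝒴\Y, and (c) A := ∑_{y∈𝒴\Y} p^r(y) ≤ min_{y'∈Y} π(y'). Then choosing ȳ ∈ Y with smallest possibility π(ȳ) and assigning p̄(y) = (π(ȳ) − A)·p̂(y)/∑_{y'∈Y'} p̂(y') to all y ∈ Y' := { y ∈ Y : π(y) ≤ π(ȳ) } violates none of the partial-sum constraints ∑_{k=1}^{j} p(y_k) ≤ π_j for indices j with π_j ≤ π(ȳ); consequently, each iteration of the greedy projection procedure assigns at least one class, and the procedure terminates after at most K iterations. -/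

import Mathlib

open scoped Classical

/-- `p` is a probability distribution on `Fin (K+1)` (the class space `𝒴`). -/
def IsDist {K : ℕ} (p : Fin (K + 1) → ℝ) : Prop :=
  (∀ i, 0 ≤ p i) ∧ (∀ i, p i ≤ 1) ∧ ∑ i, p i = 1

/-- One assignment step of the greedy projection procedure: given the set `Y` of
still-unassigned classes, the values `f` fixed so far (on `𝒴 \ Y`), and a chosen class
`ȳ`, assign to every `y ∈ Y' = { y ∈ Y : π(y) ≤ π(ȳ) }` the value
`(π(ȳ) − ∑_{y'∉Y} f(y')) · p̂(y) / ∑_{y'∈Y'} p̂(y')`, keeping all other values. -/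
noncomputable def Assign {K : ℕ} (π phat : Fin (K + 1) → ℝ) (Y : Finset (Fin (K + 1)))
    (f : Fin (K + 1) → ℝ) (ybar : Fin (K + 1)) : Fin (K + 1) → ℝ := fun y =>
  if y ∈ Y ∧ π y ≤ π ybar then
    (π ybar - ∑ z ∈ Finset.univ \ Y, f z) * phat y /
      ∑ z ∈ Y.filter (fun z => π z ≤ π ybar), phat z
  else f y

theorem assign_of_mem {K : ℕ} (π phat : Fin (K + 1) → ℝ) {Y : Finset (Fin (K + 1))}
    (f : Fin (K + 1) → ℝ) {ybar y : Fin (K + 1)} (hy : y ∈ Y ∧ π y ≤ π ybar) :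
    Assign π phat Y f ybar y = (π ybar - ∑ z ∈ Finset.univ \ Y, f z) * phat y /
      ∑ z ∈ Y.filter (fun z => π z ≤ π ybar), phat z :=
  if_pos hy

theorem assign_of_notMem {K : ℕ} (π phat : Fin (K + 1) → ℝ) {Y : Finset (Fin (K + 1))}
    (f : Fin (K + 1) → ℝ) (ybar : Fin (K + 1)) {y : Fin (K + 1)} (hy : y ∉ Y) :
    Assign π phat Y f ybar y = f y :=
  if_neg fun h => hy h.1

/-- The values assigned in one step add up to the mass that was still available at `π ybar`. -/
theorem sum_assign_filter {K : ℕ} (π phat : Fin (K + 1) → ℝ) (hpos : ∀ y, 0 < phat y)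
    (Y : Finset (Fin (K + 1))) (f : Fin (K + 1) → ℝ) {ybar : Fin (K + 1)} (hybar : ybar ∈ Y) :
    ∑ k ∈ Y.filter (fun z => π z ≤ π ybar), Assign π phat Y f ybar k =
      π ybar - ∑ z ∈ Finset.univ \ Y, f z := by
  have hS : 0 < ∑ z ∈ Y.filter (fun z => π z ≤ π ybar), phat z :=
    Finset.sum_pos (fun z _ => hpos z) ⟨ybar, by simp [hybar]⟩
  rw [Finset.sum_congr rfl fun k hk => assign_of_mem π phat f (Finset.mem_filter.1 hk),
    ← Finset.sum_div, ← Finset.mul_sum, mul_div_cancel_right₀ _ hS.ne']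

/-- **Termination.**  Under the stated invariants on the already fixed
values, choosing `ȳ ∈ Y` with smallest possibility `π(ȳ)` and performing the
proportional assignment violates none of the partial-sum constraints
`∑_{k=1}^{j} p(y_k) ≤ π_j` for indices `j` with `π_j ≤ π(ȳ)`; consequently each
iteration of the greedy projection procedure assigns at least one class (the set of
unassigned classes strictly decreases), so the procedure terminates after at most `K`
iterations. -/
theorem greedy_step_valid_and_decreasing {K : ℕ} (π phat : Fin (K + 1) → ℝ)
    (hmono : Monotone π) (hπ0 : ∀ y, 0 ≤ π y) (hnorm : π (Fin.last K) = 1)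
    (hphat : IsDist phat) (hpos : ∀ y, 0 < phat y)
    (Y : Finset (Fin (K + 1))) (hY : Y.Nonempty)
    (f : Fin (K + 1) → ℝ)
    (hf0 : ∀ y ∉ Y, 0 ≤ f y) (hf1 : ∀ y ∉ Y, f y ≤ 1)
    (horder : ∀ y ∉ Y, ∀ y' ∈ Y, π y ≤ π y')
    (hok : ∀ j ∉ Y, ∑ k ∈ Finset.Iic j, f k ≤ π j)
    (hA : ∀ y' ∈ Y, ∑ y ∈ Finset.univ \ Y, f y ≤ π y') :
    ∀ ybar ∈ Y, (∀ y ∈ Y, π ybar ≤ π y) →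
      ((∀ j : Fin (K + 1), π j ≤ π ybar →
          ∑ k ∈ Finset.Iic j, Assign π phat Y f ybar k ≤ π j) ∧
        (Y.filter fun y => π y ≤ π ybar).Nonempty ∧
        (Y.filter fun y => π ybar < π y).card < Y.card) := by
  intro ybar hybar hmin
  refine ⟨fun j hj => ?_, ⟨ybar, by simp [hybar]⟩,
    Finset.card_lt_card (Finset.filter_ssubset.2 ⟨ybar, hybar, lt_irrefl _⟩)⟩
  rcases hj.lt_or_eq with hlt | heq
  · have hout : ∀ k ≤ j, k ∉ Y := fun k hk hkY =>
      ((hmono hk).trans_lt hlt).not_ge (hmin k hkY)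
    rw [Finset.sum_congr rfl fun k hk =>
      assign_of_notMem π phat f ybar (hout k (Finset.mem_Iic.1 hk))]
    exact hok j (hout j le_rfl)
  · have hfixed : ∀ k ∈ Finset.univ \ Y, Assign π phat Y f ybar k = f k := fun k hk =>
      assign_of_notMem π phat f ybar (Finset.mem_sdiff.1 hk).2
    have hsub : Finset.Iic j ⊆
        (Finset.univ \ Y) ∪ Y.filter (fun z => π z ≤ π ybar) := by
      intro k hk
      have hkj := (hmono (Finset.mem_Iic.1 hk)).trans hj
      by_cases hkY : k ∈ Y <;> simp [hkY, hkj]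
    have hdisj : Disjoint (Finset.univ \ Y) (Y.filter (fun z => π z ≤ π ybar)) :=
      Finset.sdiff_disjoint.mono_right (Finset.filter_subset _ _)
    have hnonneg : ∀ k, k ∈ (Finset.univ \ Y) ∪ Y.filter (fun z => π z ≤ π ybar) →
        0 ≤ Assign π phat Y f ybar k := by
      intro k hk
      rcases Finset.mem_union.1 hk with h | h
      · rw [hfixed k h]
        exact hf0 k (Finset.mem_sdiff.1 h).2
      · rw [assign_of_mem π phat f (Finset.mem_filter.1 h)]
        exact div_nonneg (mul_nonneg (sub_nonneg.2 (hA ybar hybar)) (hpos k).le)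
          (Finset.sum_nonneg fun z _ => (hpos z).le)
    refine (Finset.sum_le_sum_of_subset_of_nonneg hsub fun k hk _ => hnonneg k hk).trans ?_
    rw [Finset.sum_union hdisj, Finset.sum_congr rfl hfixed,
      sum_assign_filter π phat hpos Y f hybar, heq]
    linarith
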